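/- A linear mapping φ : S_n → S_n satisfies φ(C_n) = C_n if and only if there exists a nonnegative monomial matrix m such that φ(x) = mᵀxm for all x ∈ S_n. -/

import Mathlib

open Matrix

/-- A matrix is copositive if its quadratic form is nonnegative on the nonnegative orthant. -/
def Copositive {m : Type*} [Fintype m] (a : Matrix m m ℝ) : Prop :=
  ∀ u : m → ℝ, (∀ i, 0 ≤ u i) → 0 ≤ u ⬝ᵥ a *ᵥ u

/-- The submodule of symmetric n×n real matrices. -/
def Sn (n : ℕ) : Submodule ℝ (Matrix (Fin n) (Fin n) ℝ) where
  carrier := {a | a.IsSymm}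
  add_mem' := fun ha hb => ha.add hb
  zero_mem' := Matrix.isSymm_zero
  smul_mem' := fun c a ha => ha.smul c

/-- The copositive cone, as a subset of the symmetric matrices. -/
def Cn (n : ℕ) : Set (Sn n) := {a | Copositive a.1}

/-- The set A^t : symmetric matrices with (t,t) entry zero, all other entries positive. -/
def At (n : ℕ) (t : Fin n) : Set (Sn n) :=
  {a | a.1 t t = 0 ∧ ∀ i j, (i, j) ≠ (t, t) → 0 < a.1 i j}

/-- T_n : symmetric nonnegative matrices with zero diagonal. -/
def Tn (n : ℕ) : Set (Sn n) := {a | (∀ i j, 0 ≤ a.1 i j) ∧ ∀ i, a.1 i i = 0}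

/-- A monomial matrix: exactly one nonzero entry in each row and column. -/
def IsMonomial {n : ℕ} (m : Matrix (Fin n) (Fin n) ℝ) : Prop :=
  (∀ i, ∃! j, m i j ≠ 0) ∧ (∀ j, ∃! i, m i j ≠ 0)

/-- Evaluation of the quadratic form at `u`, as a linear functional of the symmetric matrix. -/
noncomputable def quadEval {n : ℕ} (u : Fin n → ℝ) : Sn n →ₗ[ℝ] ℝ where
  toFun x := u ⬝ᵥ x.1 *ᵥ u
  map_add' x y := by simp [Matrix.add_mulVec, dotProduct_add]
  map_smul' c x := by simp [Matrix.smul_mulVec, dotProduct_smul]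

/-- The symmetric matrix `zwᵀ + wzᵀ`. -/
noncomputable def symProd {n : ℕ} (z w : Fin n → ℝ) : Sn n :=
  ⟨vecMulVec z w + vecMulVec w z, by
    ext i j
    simp [vecMulVec_apply]
    ring⟩

/-- The symmetric matrix `zzᵀ`. -/
noncomputable def rankOne {n : ℕ} (z : Fin n → ℝ) : Sn n :=
  ⟨vecMulVec z z, by
    ext i j
    simp [vecMulVec_apply]
    ring⟩

/-- The matrix unit symmetrization `e_a e_bᵀ + e_b e_aᵀ`. -/
noncomputable def symUnit {n : ℕ} (a b : Fin n) : Sn n :=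
  symProd (Pi.single a 1) (Pi.single b 1)

section

variable {n : ℕ}

theorem quadEval_apply (u : Fin n → ℝ) (x : Sn n) : quadEval u x = u ⬝ᵥ x.1 *ᵥ u := rfl

theorem quadEval_rankOne (u z : Fin n → ℝ) : quadEval u (rankOne z) = (u ⬝ᵥ z) ^ 2 := by
  simp only [quadEval_apply, rankOne, vecMulVec_mulVec, dotProduct_smul]
  rw [dotProduct_comm z u]
  simp
  ring

theorem quadEval_symProd (u z w : Fin n → ℝ) :
    quadEval u (symProd z w) = 2 * (u ⬝ᵥ z) * (u ⬝ᵥ w) := by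
  simp only [quadEval_apply, symProd, add_mulVec, vecMulVec_mulVec, dotProduct_smul,
    dotProduct_add]
  rw [dotProduct_comm z u, dotProduct_comm w u]
  simp
  ring

theorem quadEval_symUnit (u : Fin n → ℝ) (a b : Fin n) :
    quadEval u (symUnit a b) = 2 * u a * u b := by
  simp [symUnit, quadEval_symProd]

theorem quadEval_smul (c : ℝ) (u : Fin n → ℝ) (x : Sn n) :
    quadEval (c • u) x = c ^ 2 * quadEval u x := by
  simp [quadEval_apply, mulVec_smul]
  ring

theorem quadEval_add_smul (u v : Fin n → ℝ) (t : ℝ) (x : Sn n) :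
    quadEval (u + t • v) x =
      quadEval u x + t * (u ⬝ᵥ x.1 *ᵥ v + v ⬝ᵥ x.1 *ᵥ u) + t ^ 2 * quadEval v x := by
  simp [quadEval_apply, mulVec_smul, mulVec_add]
  ring

theorem rankOne_smul (c : ℝ) (z : Fin n → ℝ) : rankOne (c • z) = c ^ 2 • rankOne z := by
  ext i j
  simp [rankOne, vecMulVec_apply]
  ring

theorem rankOne_add_smul (z w : Fin n → ℝ) (t : ℝ) :
    rankOne (z + t • w) = rankOne z + t • symProd z w + t ^ 2 • rankOne w := by
  ext i j
  simp [rankOne, symProd, vecMulVec_apply]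
  ring

theorem eq_sum_symUnit (x : Sn n) : x = ∑ a, ∑ b, (x.1 a b / 2) • symUnit a b := by
  ext i j
  have hx : x.1 j i = x.1 i j := x.2.apply i j
  simp only [AddSubmonoidClass.coe_finsetSum, SetLike.val_smul, Matrix.sum_apply,
    Matrix.smul_apply, symUnit, symProd, Matrix.add_apply, vecMulVec_apply, Pi.single_apply,
    smul_eq_mul, mul_add, Finset.sum_add_distrib]
  simp [hx]

/-- Functionals on symmetric matrices are determined by their values on the matrices `zzᵀ`. -/
theorem functional_ext_rankOne {g h : Sn n →ₗ[ℝ] ℝ}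
    (H : ∀ z, g (rankOne z) = h (rankOne z)) : g = h := by
  have key (z w : Fin n → ℝ) : g (symProd z w) = h (symProd z w) := by
    have e := rankOne_add_smul z w 1
    have e1 : symProd z w = rankOne (z + (1 : ℝ) • w) - rankOne z - rankOne w := by
      rw [e]
      simp only [one_smul, one_pow]
      abel
    rw [e1]
    simp only [map_sub, H]
  ext x
  rw [eq_sum_symUnit x]
  simp [symUnit, key]

/-- A matrix is determined by its quadratic form on the nonnegative orthant. -/
theorem quadEval_ext {x y : Sn n}
    (H : ∀ u : Fin n → ℝ, (∀ i, 0 ≤ u i) → quadEval u x = quadEval u y) : x = y := by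
  have single (a : Fin n) (z : Sn n) : quadEval (Pi.single a 1) z = z.1 a a := by
    simp [quadEval_apply]
  have hs (a : Fin n) : ∀ i, 0 ≤ (Pi.single a 1 : Fin n → ℝ) i := fun i => by
    by_cases h : i = a <;> simp [h]
  have pair (a b : Fin n) (z : Sn n) :
      quadEval (Pi.single a 1 + (1 : ℝ) • Pi.single b 1) z =
        z.1 a a + 2 * z.1 a b + z.1 b b := by
    have hz : z.1 b a = z.1 a b := z.2.apply a b
    rw [quadEval_add_smul, single, single]
    simp [hz]
    ring
  ext a b
  have h1 := H _ (hs a)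
  have h2 := H _ (hs b)
  have h3 := H (Pi.single a 1 + (1 : ℝ) • Pi.single b 1) fun i => by
    simpa using add_nonneg (hs a i) (hs b i)
  rw [single, single] at h1 h2
  rw [pair, pair] at h3
  linarith

theorem eq_of_quadEval_eq {v w : Fin n → ℝ} (hv : ∀ i, 0 ≤ v i) (hw : ∀ i, 0 ≤ w i)
    (H : ∀ x, quadEval v x = quadEval w x) : v = w := by
  ext a
  have h := H (symUnit a a)
  rw [quadEval_symUnit, quadEval_symUnit] at h
  exact (sq_eq_sq₀ (hv a) (hw a)).1 (by linarith)

theorem mem_Cn_iff {x : Sn n} :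
    x ∈ Cn n ↔ ∀ u : Fin n → ℝ, (∀ i, 0 ≤ u i) → 0 ≤ quadEval u x := Iff.rfl

theorem rankOne_mem_Cn (z : Fin n → ℝ) : rankOne z ∈ Cn n := fun u _ => by
  rw [← quadEval_apply, quadEval_rankOne]
  positivity

theorem mem_Cn_of_nonneg {x : Sn n} (hx : ∀ i j, 0 ≤ x.1 i j) : x ∈ Cn n := fun u hu =>
  Finset.sum_nonneg fun i _ => mul_nonneg (hu i) <|
    show 0 ≤ ∑ j, x.1 i j * u j from Finset.sum_nonneg fun j _ => mul_nonneg (hx i j) (hu j)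

theorem exists_smul_add_mem_Cn (x : Sn n) :
    ∃ c : ℝ, c • rankOne (1 : Fin n → ℝ) + x ∈ Cn n ∧ c • rankOne (1 : Fin n → ℝ) - x ∈ Cn n := by
  have hb (i j : Fin n) : |x.1 i j| ≤ ∑ i, ∑ j, |x.1 i j| :=
    (Finset.single_le_sum (f := fun j => |x.1 i j|) (fun _ _ => abs_nonneg _)
      (Finset.mem_univ j)).trans
    (Finset.single_le_sum (f := fun i => ∑ j, |x.1 i j|)
      (fun _ _ => Finset.sum_nonneg fun _ _ => abs_nonneg _) (Finset.mem_univ i))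
  refine ⟨∑ i, ∑ j, |x.1 i j|, mem_Cn_of_nonneg fun i j => ?_, mem_Cn_of_nonneg fun i j => ?_⟩
  · have := neg_abs_le (x.1 i j)
    have := hb i j
    simp [rankOne]
    linarith
  · have := le_abs_self (x.1 i j)
    have := hb i j
    simp [rankOne]
    linarith

theorem functional_eq_zero {f : Sn n →ₗ[ℝ] ℝ} (hf : ∀ x ∈ Cn n, 0 ≤ f x)
    (h : f (rankOne 1) = 0) : f = 0 := by
  ext x
  obtain ⟨c, h1, h2⟩ := exists_smul_add_mem_Cn x
  have h1 := hf _ h1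
  have h2 := hf _ h2
  simp [h] at h1 h2
  simpa using le_antisymm h2 h1

/-- A nonzero functional in the dual of the copositive cone that vanishes at a copositive matrix
forces the quadratic form of that matrix to vanish somewhere on the standard simplex. -/
theorem exists_quadEval_eq_zero {f : Sn n →ₗ[ℝ] ℝ} (hf : ∀ x ∈ Cn n, 0 ≤ f x) (hf0 : f ≠ 0)
    {y : Sn n} (hy : y ∈ Cn n) (hfy : f y = 0) :
    ∃ v ∈ stdSimplex ℝ (Fin n), quadEval v y = 0 := by
  have hJ : 0 < f (rankOne 1) :=
    (hf _ (rankOne_mem_Cn _)).lt_of_ne' fun h => hf0 (functional_eq_zero hf h)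
  have hne : (stdSimplex ℝ (Fin n)).Nonempty := by
    rcases isEmpty_or_nonempty (Fin n) with he | ⟨⟨i⟩⟩
    · refine absurd ?_ hf0
      ext x
      have : x = 0 := by ext i; exact isEmptyElim i
      simp [this]
    · exact ⟨_, single_mem_stdSimplex ℝ i⟩
  have hcont : Continuous fun v : Fin n → ℝ => quadEval v y := by
    simp only [quadEval_apply, dotProduct, mulVec]
    fun_prop
  obtain ⟨v, hv, hmin⟩ := (isCompact_stdSimplex ℝ (Fin n)).exists_isMinOn hne hcont.continuousOn
  refine ⟨v, hv, le_antisymm ?_ (hy v hv.1)⟩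
  have hmem : y - quadEval v y • rankOne 1 ∈ Cn n := by
    rw [mem_Cn_iff]
    intro w hw
    rw [map_sub, map_smul, quadEval_rankOne, smul_eq_mul, dotProduct_one]
    rcases (Finset.sum_nonneg fun i (_ : i ∈ Finset.univ) => hw i).eq_or_lt with hs | hs
    · simpa [← hs, quadEval_apply] using hy w hw
    · set s := ∑ i, w i
      have hm : s⁻¹ • w ∈ stdSimplex ℝ (Fin n) :=
        ⟨fun i => mul_nonneg (inv_nonneg.2 hs.le) (hw i), by
          simp only [Pi.smul_apply, smul_eq_mul, ← Finset.mul_sum]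
          exact inv_mul_cancel₀ hs.ne'⟩
      have h1 : quadEval v y ≤ quadEval (s⁻¹ • w) y := hmin hm
      have h2 : quadEval w y = s ^ 2 * quadEval (s⁻¹ • w) y := by
        rw [quadEval_smul]
        field_simp
      rw [h2]
      nlinarith [sq_nonneg s]
  have h := hf _ hmem
  rw [map_sub, map_smul, hfy, smul_eq_mul] at h
  by_contra! hpos
  nlinarith [mul_pos hpos hJ]

theorem map_rankOne_add_of_eq_zero {g : Sn n →ₗ[ℝ] ℝ} (hg : ∀ z, 0 ≤ g (rankOne z))
    {w : Fin n → ℝ} (hw : g (rankOne w) = 0) (z : Fin n → ℝ) (t : ℝ) :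
    g (rankOne (z + t • w)) = g (rankOne z) := by
  have hexp (t : ℝ) : g (rankOne (z + t • w)) = g (rankOne z) + t * g (symProd z w) := by
    simp [rankOne_add_smul, hw]
  have hb : g (symProd z w) = 0 := by
    by_contra hb
    have h := hg (z + (-(g (rankOne z) + 1) / g (symProd z w)) • w)
    rw [hexp, div_mul_cancel₀ _ hb] at h
    linarith
  rw [hexp, hb, mul_zero, add_zero]

/-- The vector `u_j e_i - u_i e_j`, orthogonal to `u`. -/
noncomputable def orthVec (u : Fin n → ℝ) (p : Fin n × Fin n) : Fin n → ℝ :=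
  u p.2 • Pi.single p.1 1 - u p.1 • Pi.single p.2 1

theorem dotProduct_orthVec (u : Fin n → ℝ) (p : Fin n × Fin n) : u ⬝ᵥ orthVec u p = 0 := by
  simp [orthVec]
  ring

theorem sum_smul_orthVec (u z : Fin n → ℝ) :
    (u ⬝ᵥ z) • u + ∑ p : Fin n × Fin n, (z p.1 * u p.2) • orthVec u p = (u ⬝ᵥ u) • z := by
  ext i
  simp only [Fintype.sum_prod_type, Pi.add_apply, Finset.sum_apply, Pi.smul_apply, orthVec,
    Pi.sub_apply, smul_eq_mul, Pi.single_apply, mul_sub, Finset.sum_sub_distrib]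
  simp [dotProduct, Finset.sum_mul]
  rw [← sub_eq_zero]
  simp only [← Finset.sum_sub_distrib, ← Finset.sum_add_distrib]
  refine Finset.sum_eq_zero fun j _ => ?_
  ring

/-- A functional that is nonnegative on positive semidefinite matrices and vanishes on the
matrices `wwᵀ` with `w` orthogonal to `u` is a multiple of the evaluation at `u`. -/
theorem exists_eq_smul_quadEval {g : Sn n →ₗ[ℝ] ℝ} (hg : ∀ z, 0 ≤ g (rankOne z))
    {u : Fin n → ℝ} (hu : u ≠ 0) (h0 : ∀ p, g (rankOne (orthVec u p)) = 0) :
    ∃ c : ℝ, g = c • quadEval u := by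
  have huu : u ⬝ᵥ u ≠ 0 := fun h => hu (dotProduct_self_eq_zero.1 h)
  refine ⟨g (rankOne u) / (u ⬝ᵥ u) ^ 2, functional_ext_rankOne fun z => ?_⟩
  have hsum (s : Finset (Fin n × Fin n)) (a : Fin n × Fin n → ℝ) (y : Fin n → ℝ) :
      g (rankOne (y + ∑ p ∈ s, a p • orthVec u p)) = g (rankOne y) := by
    induction s using Finset.induction_on with
    | empty => simp
    | insert p s hp ih =>
      rw [Finset.sum_insert hp, add_comm (a p • _), ← add_assoc,
        map_rankOne_add_of_eq_zero hg (h0 p), ih]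
  have h := hsum Finset.univ (fun p => z p.1 * u p.2) ((u ⬝ᵥ z) • u)
  rw [sum_smul_orthVec, rankOne_smul, rankOne_smul, map_smul, map_smul, smul_eq_mul,
    smul_eq_mul] at h
  rw [LinearMap.smul_apply, quadEval_rankOne, smul_eq_mul]
  field_simp
  linarith

/-- The transpose of an automorphism of the copositive cone preserves the extreme rays of the
dual cone. -/
theorem exists_quadEval_comp (e : Sn n ≃ₗ[ℝ] Sn n) (he : ∀ x, e x ∈ Cn n ↔ x ∈ Cn n)
    (u : Fin n → ℝ) (hu : ∀ i, 0 ≤ u i) :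
    ∃ v : Fin n → ℝ, (∀ i, 0 ≤ v i) ∧ ∀ x, quadEval u (e x) = quadEval v x := by
  rcases eq_or_ne u 0 with rfl | hu0
  · exact ⟨0, fun _ => le_rfl, fun x => by simp [quadEval_apply]⟩
  have huu : u ⬝ᵥ u ≠ 0 := fun h => hu0 (dotProduct_self_eq_zero.1 h)
  set f : Sn n →ₗ[ℝ] ℝ := quadEval u ∘ₗ e.toLinearMap with hfdef
  have hf : ∀ x ∈ Cn n, 0 ≤ f x := fun x hx => (he x).2 hx u hu
  have hf0 : f ≠ 0 := fun h => by
    have h1 := LinearMap.congr_fun h (e.symm (rankOne u))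
    simp [hfdef, quadEval_rankOne, huu] at h1
  set x : Sn n := ∑ p, rankOne (orthVec u p) with hx
  have hxC : x ∈ Cn n := by
    rw [mem_Cn_iff]
    intro w hw
    rw [hx, map_sum]
    exact Finset.sum_nonneg fun p _ => rankOne_mem_Cn _ w hw
  obtain ⟨v, hv, hv0⟩ := exists_quadEval_eq_zero hf hf0 (y := e.symm x)
    ((he _).1 (by simpa using hxC)) (by simp [hfdef, hx, quadEval_rankOne, dotProduct_orthVec])
  set g : Sn n →ₗ[ℝ] ℝ := quadEval v ∘ₗ e.symm.toLinearMap with hgdef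
  have hg : ∀ z, 0 ≤ g (rankOne z) := fun z =>
    (he _).1 (by simpa using rankOne_mem_Cn z) v hv.1
  have hgx : ∑ p, g (rankOne (orthVec u p)) = 0 := by
    rw [← map_sum]
    exact hv0
  obtain ⟨c, hc⟩ := exists_eq_smul_quadEval hg hu0 fun p =>
    (Finset.sum_eq_zero_iff_of_nonneg fun p _ => hg _).1 hgx p (Finset.mem_univ p)
  have hvf (y : Sn n) : quadEval v y = c * f y := by
    have := LinearMap.congr_fun hc (e y)
    simpa [hgdef, hfdef] using this
  have hcpos : 0 < c := by
    have h1 := hvf (rankOne 1)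
    rw [quadEval_rankOne, dotProduct_one, hv.2] at h1
    have h2 := hf _ (rankOne_mem_Cn 1)
    by_contra! hc
    nlinarith [mul_nonpos_of_nonpos_of_nonneg hc h2]
  refine ⟨(√c)⁻¹ • v, fun i => mul_nonneg (by positivity) (hv.1 i), fun y => ?_⟩
  rw [quadEval_smul, hvf, inv_pow, Real.sq_sqrt hcpos.le, inv_mul_cancel_left₀ hcpos.ne']
  rfl

/-- If `(x² + tp + t²y²)(z² + tq + t²w²) = (xz + tr + t²yw)²` with `(x, y)`, `(z, w)` linearly
independent and the right-hand factor nonnegative for `t ≥ 0`, then `p = 2xy`. -/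
theorem middle_coeff_eq {x y z w p q r : ℝ} (hx : 0 ≤ x) (hy : 0 ≤ y) (hz : 0 ≤ z) (hw : 0 ≤ w)
    (hD : x * w - y * z ≠ 0)
    (hP : ∀ t : ℝ, 0 ≤ t → (x ^ 2 + t * p + t ^ 2 * y ^ 2) * (z ^ 2 + t * q + t ^ 2 * w ^ 2) =
      (x * z + t * r + t ^ 2 * (y * w)) ^ 2)
    (hr : ∀ t : ℝ, 0 ≤ t → 0 ≤ x * z + t * r + t ^ 2 * (y * w)) :
    p = 2 * x * y ∧ q = 2 * z * w := by
  have h1 := hP 1 (by norm_num)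
  have h2 := hP 2 (by norm_num)
  have h3 := hP 3 (by norm_num)
  have e1 : x ^ 2 * q + z ^ 2 * p = 2 * x * z * r := by linarith
  have e2 : y ^ 2 * q + w ^ 2 * p = 2 * y * w * r := by linarith
  have e3 : (x * w - y * z) ^ 2 + p * q = r ^ 2 := by linarith
  obtain ⟨ν, hν⟩ : ∃ ν, ν = z * w * (p - 2 * x * y) - (y * z + x * w) * (r - (x * w + y * z)) +
    x * y * (q - 2 * z * w) := ⟨_, rfl⟩
  have hp : (x * w - y * z) ^ 2 * (p - 2 * x * y) = -2 * x * y * ν := by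
    rw [hν]
    linear_combination y ^ 2 * e1 + x ^ 2 * e2
  have hq : (x * w - y * z) ^ 2 * (q - 2 * z * w) = -2 * z * w * ν := by
    rw [hν]
    linear_combination w ^ 2 * e1 + z ^ 2 * e2
  have hr' : (x * w - y * z) ^ 2 * (r - (x * w + y * z)) = -(y * z + x * w) * ν := by
    rw [hν]
    linear_combination y * w * e1 + x * z * e2
  have hdet : 2 * ν + (p - 2 * x * y) * (q - 2 * z * w) - (r - (x * w + y * z)) ^ 2 = 0 := by
    rw [hν]
    linear_combination e3
  have hD2 : (x * w - y * z) ^ 2 ≠ 0 := pow_ne_zero 2 hD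
  have hquad : ν * (ν - 2 * (x * w - y * z) ^ 2) = 0 := by
    refine (mul_eq_zero.1 (?_ : (x * w - y * z) ^ 2 * _ = 0)).resolve_left hD2
    linear_combination (-(x * w - y * z) ^ 4) * hdet +
      (x * w - y * z) ^ 2 * (q - 2 * z * w) * hp + (-2 * x * y * ν) * hq -
      ((x * w - y * z) ^ 2 * (r - (x * w + y * z)) - (y * z + x * w) * ν) * hr'
  rcases mul_eq_zero.1 hquad with h0 | h0
  · rw [h0, mul_zero] at hp hq
    exact ⟨sub_eq_zero.1 ((mul_eq_zero.1 hp).resolve_left hD2),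
      sub_eq_zero.1 ((mul_eq_zero.1 hq).resolve_left hD2)⟩
  · exfalso
    have hrv : r = -(x * w + y * z) := by
      refine mul_left_cancel₀ hD2 ?_
      linear_combination hr' - (y * z + x * w) * h0
    have hyw : 0 < y + w := (add_nonneg hy hw).lt_of_ne' fun h => hD (by
      have : y = 0 := by linarith
      have : w = 0 := by linarith
      simp [*])
    have h := hr ((x + z) / (y + w)) (by positivity)
    rw [hrv] at h
    have hval : x * z + (x + z) / (y + w) * (-(x * w + y * z)) +
        ((x + z) / (y + w)) ^ 2 * (y * w) = -((x * w - y * z) / (y + w)) ^ 2 := by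
      field_simp
      ring
    rw [hval] at h
    have : 0 < ((x * w - y * z) / (y + w)) ^ 2 := by positivity
    linarith

/-- Additivity of the map induced on vectors by an automorphism of the copositive cone. -/
theorem add_of_quadEval_comp (e : Sn n ≃ₗ[ℝ] Sn n) {T : (Fin n → ℝ) → Fin n → ℝ}
    (hT0 : ∀ u, (∀ i, 0 ≤ u i) → ∀ i, 0 ≤ T u i)
    (hT : ∀ u, (∀ i, 0 ≤ u i) → ∀ x, quadEval u (e x) = quadEval (T u) x)
    {u v : Fin n → ℝ} (hu : ∀ i, 0 ≤ u i) (hv : ∀ i, 0 ≤ v i) :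
    T (u + v) = T u + T v := by
  have hadd {t : ℝ} (ht : 0 ≤ t) (i : Fin n) : 0 ≤ (u + t • v) i :=
    add_nonneg (hu i) (mul_nonneg ht (hv i))
  have huv (i : Fin n) : 0 ≤ (u + v) i := add_nonneg (hu i) (hv i)
  by_cases hdep : ∀ a b, T u a * T v b - T v a * T u b = 0
  · by_cases hα : T u = 0
    · have hu0 : u = 0 := eq_of_quadEval_eq hu (fun _ => le_rfl) fun x => by
        have := hT u hu (e.symm x)
        rw [e.apply_symm_apply, hα] at this
        rw [this]
        simp [quadEval_apply]
      rw [hα, hu0, zero_add, zero_add]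
    · obtain ⟨a, ha⟩ := Function.ne_iff.1 hα
      rw [Pi.zero_apply] at ha
      have hk : 0 ≤ T v a / T u a := div_nonneg (hT0 v hv a) (hT0 u hu a)
      set k := T v a / T u a with hkdef
      have hβ : T v = k • T u := by
        ext b
        have := hdep a b
        rw [Pi.smul_apply, smul_eq_mul, hkdef]
        field_simp
        linarith
      have hvk : v = k • u := eq_of_quadEval_eq hv (fun i => mul_nonneg hk (hu i)) fun x => by
        rw [← e.apply_symm_apply x, hT v hv, hβ, quadEval_smul, quadEval_smul, hT u hu]
      have h1 : u + v = (1 + k) • u := by rw [hvk, add_smul, one_smul]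
      rw [show T u + T v = (1 + k) • T u by rw [hβ, add_smul, one_smul]]
      refine eq_of_quadEval_eq (hT0 _ huv)
        (fun i => mul_nonneg (by positivity) (hT0 u hu i)) fun x => ?_
      rw [← hT _ huv, h1, quadEval_smul, quadEval_smul, hT u hu]
  · push Not at hdep
    obtain ⟨a, b, hab⟩ := hdep
    obtain ⟨M, hM⟩ : ∃ M : Fin n → Fin n → ℝ, ∀ c d (t : ℝ), 0 ≤ t →
        T (u + t • v) c * T (u + t • v) d =
          T u c * T u d + t * M c d + t ^ 2 * (T v c * T v d) := by
      refine ⟨fun c d => (u ⬝ᵥ (e (symUnit c d)).1 *ᵥ v + v ⬝ᵥ (e (symUnit c d)).1 *ᵥ u) / 2,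
        fun c d t ht => ?_⟩
      have h := hT _ (hadd ht) (symUnit c d)
      rw [quadEval_add_smul, hT u hu, hT v hv, quadEval_symUnit, quadEval_symUnit,
        quadEval_symUnit] at h
      linarith
    have hP (c d : Fin n) (t : ℝ) (ht : 0 ≤ t) :
        (T u c ^ 2 + t * M c c + t ^ 2 * T v c ^ 2) * (T u d ^ 2 + t * M d d + t ^ 2 * T v d ^ 2) =
          (T u c * T u d + t * M c d + t ^ 2 * (T v c * T v d)) ^ 2 := by
      have h1 := hM c c t ht
      have h2 := hM d d t ht
      rw [← hM c d t ht, sq (T u c), sq (T v c), sq (T u d), sq (T v d), ← h1, ← h2]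
      ring
    have hind (c d : Fin n) (hcd : T u c * T v d - T v c * T u d ≠ 0) :
        M c c = 2 * T u c * T v c ∧ M d d = 2 * T u d * T v d :=
      middle_coeff_eq (hT0 u hu c) (hT0 v hv c) (hT0 u hu d) (hT0 v hv d) hcd (hP c d)
        fun t ht => by
          rw [← hM c d t ht]
          exact mul_nonneg (hT0 _ (hadd ht) c) (hT0 _ (hadd ht) d)
    have hall (c : Fin n) : M c c = 2 * T u c * T v c := by
      by_cases h1 : T u a * T v c - T v a * T u c = 0
      · by_cases h2 : T u b * T v c - T v b * T u c = 0
        · have hc1 : T u c = 0 := by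
            refine (mul_eq_zero.1 (?_ : _ * T u c = 0)).resolve_left hab
            linear_combination T u b * h1 - T u a * h2
          have hc2 : T v c = 0 := by
            refine (mul_eq_zero.1 (?_ : _ * T v c = 0)).resolve_left hab
            linear_combination T v b * h1 - T v a * h2
          have ha := (hind a b hab).1
          have t1 := hP a c 1 (by norm_num)
          have t2 := hP a c 2 (by norm_num)
          have t3 := hP a c 3 (by norm_num)
          rw [hc1, hc2, ha] at t1 t2 t3
          have hα : T u a ^ 2 * M c c = 0 := by linarith
          have hβ : T v a ^ 2 * M c c = 0 := by linarith
          rw [hc1, mul_zero, zero_mul]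
          by_contra hne
          have hα0 := pow_eq_zero_iff two_ne_zero |>.1 ((mul_eq_zero.1 hα).resolve_right hne)
          have hβ0 := pow_eq_zero_iff two_ne_zero |>.1 ((mul_eq_zero.1 hβ).resolve_right hne)
          exact hab (by rw [hα0, hβ0]; ring)
        · exact (hind b c h2).2
      · exact (hind a c h1).2
    ext c
    have h := hM c c 1 zero_le_one
    rw [hall c, one_smul] at h
    refine (sq_eq_sq₀ (hT0 _ huv c) (add_nonneg (hT0 u hu c) (hT0 v hv c))).1 ?_
    linarith

theorem exists_matrix_quadEval_comp (e : Sn n ≃ₗ[ℝ] Sn n) (he : ∀ x, e x ∈ Cn n ↔ x ∈ Cn n) :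
    ∃ m : Matrix (Fin n) (Fin n) ℝ, (∀ i j, 0 ≤ m i j) ∧
      ∀ u : Fin n → ℝ, (∀ i, 0 ≤ u i) → ∀ x, quadEval u (e x) = quadEval (m *ᵥ u) x := by
  choose! T hT0 hT using exists_quadEval_comp e he
  have hs (a : Fin n) : ∀ i, 0 ≤ (Pi.single a 1 : Fin n → ℝ) i := fun i => by
    by_cases h : i = a <;> simp [h]
  have hsmul (c : ℝ) (hc : 0 ≤ c) (u : Fin n → ℝ) (hu : ∀ i, 0 ≤ u i) : T (c • u) = c • T u := by
    have hcu (i : Fin n) : 0 ≤ (c • u) i := mul_nonneg hc (hu i)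
    refine eq_of_quadEval_eq (hT0 _ hcu) (fun i => mul_nonneg hc (hT0 u hu i)) fun x => ?_
    rw [← hT _ hcu, quadEval_smul, quadEval_smul, hT u hu]
  refine ⟨Matrix.of fun i j => T (Pi.single j 1) i, fun i j => hT0 _ (hs j) i, fun u hu x => ?_⟩
  have hterm (j i : Fin n) : 0 ≤ (u j • (Pi.single j 1 : Fin n → ℝ)) i :=
    mul_nonneg (hu j) (hs j i)
  have hsum (s : Finset (Fin n)) :
      T (∑ j ∈ s, u j • Pi.single j 1) = ∑ j ∈ s, u j • T (Pi.single j 1) := by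
    induction s using Finset.induction_on with
    | empty => simpa using hsmul 0 le_rfl 0 fun _ => le_rfl
    | insert j s hj ih =>
      rw [Finset.sum_insert hj, Finset.sum_insert hj, add_of_quadEval_comp e hT0 hT (hterm j), ih,
        hsmul _ (hu j) _ (hs j)]
      intro i
      rw [Finset.sum_apply]
      exact Finset.sum_nonneg fun k _ => hterm k i
  have hTu : T u = (Matrix.of fun i j => T (Pi.single j 1) i) *ᵥ u := by
    have hu' : u = ∑ j, u j • (Pi.single j 1 : Fin n → ℝ) := by
      ext i
      simp [Finset.sum_apply, Pi.single_apply]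
    conv_lhs => rw [hu', hsum]
    ext i
    simp [mulVec, dotProduct, mul_comm]
  rw [hT u hu, hTu]

theorem existsUnique_ne_zero_of_mul_eq_one {m m' : Matrix (Fin n) (Fin n) ℝ}
    (hm : ∀ i j, 0 ≤ m i j) (hm' : ∀ i j, 0 ≤ m' i j) (h : m * m' = 1) (i : Fin n) :
    ∃! j, m i j ≠ 0 := by
  have h' : m' * m = 1 := mul_eq_one_comm.1 h
  have hzero {j l : Fin n} (hj : m i j ≠ 0) (hl : l ≠ i) : m' j l = 0 := by
    have h1 := congr_fun₂ h i l
    rw [Matrix.mul_apply, Matrix.one_apply_ne hl.symm,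
      Finset.sum_eq_zero_iff_of_nonneg fun k _ => mul_nonneg (hm i k) (hm' k l)] at h1
    exact (mul_eq_zero.1 (h1 j (Finset.mem_univ j))).resolve_left hj
  have hrow {j : Fin n} (hj : m i j ≠ 0) (k : Fin n) : (m' * m) j k = m' j i * m i k := by
    rw [Matrix.mul_apply]
    exact Finset.sum_eq_single i (fun l _ hl => by rw [hzero hj hl, zero_mul]) (by simp)
  obtain ⟨j, hj⟩ : ∃ j, m i j ≠ 0 := by
    by_contra! hall
    have h1 := congr_fun₂ h i i
    simp [Matrix.mul_apply, hall] at h1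
  refine ⟨j, hj, fun k hk => ?_⟩
  by_contra hkj
  have h1 := hrow hj k
  have h2 := hrow hj j
  rw [h', Matrix.one_apply_ne (Ne.symm hkj)] at h1
  rw [h', Matrix.one_apply_eq] at h2
  rcases mul_eq_zero.1 h1.symm with h3 | h3
  · rw [h3, zero_mul] at h2
    exact one_ne_zero h2
  · exact hk h3

theorem isMonomial_of_mul_eq_one {m m' : Matrix (Fin n) (Fin n) ℝ}
    (hm : ∀ i j, 0 ≤ m i j) (hm' : ∀ i j, 0 ≤ m' i j) (h : m * m' = 1) : IsMonomial m :=
  ⟨existsUnique_ne_zero_of_mul_eq_one hm hm' h,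
    existsUnique_ne_zero_of_mul_eq_one (m := mᵀ) (m' := m'ᵀ) (fun i j => hm j i)
      (fun i j => hm' j i) (by rw [← Matrix.transpose_mul, mul_eq_one_comm.1 h, transpose_one])⟩

theorem exists_nonneg_inverse {m : Matrix (Fin n) (Fin n) ℝ} (hmon : IsMonomial m)
    (hm : ∀ i j, 0 ≤ m i j) :
    ∃ m' : Matrix (Fin n) (Fin n) ℝ, (∀ i j, 0 ≤ m' i j) ∧ m * m' = 1 := by
  refine ⟨Matrix.of fun i j => (m j i)⁻¹, fun i j => inv_nonneg.2 (hm j i), ?_⟩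
  ext i k
  obtain ⟨j, hj, huniq⟩ := hmon.1 i
  rw [Matrix.mul_apply, Finset.sum_eq_single j]
  · rcases eq_or_ne i k with rfl | hik
    · simpa using mul_inv_cancel₀ hj
    · have hk : m k j = 0 := by
        by_contra hk
        exact hik ((hmon.2 j).unique hj hk)
      simp [hk, hik]
  · intro l _ hl
    have : m i l = 0 := by
      by_contra h
      exact hl (huniq l h)
    simp [this]
  · simp

theorem dotProduct_congruence (m a : Matrix (Fin n) (Fin n) ℝ) (u : Fin n → ℝ) :
    u ⬝ᵥ (mᵀ * a * m) *ᵥ u = (m *ᵥ u) ⬝ᵥ a *ᵥ (m *ᵥ u) := by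
  rw [← mulVec_mulVec, ← mulVec_mulVec, dotProduct_mulVec, vecMul_transpose]

theorem mulVec_nonneg_of_nonneg {m : Matrix (Fin n) (Fin n) ℝ} (hm : ∀ i j, 0 ≤ m i j)
    {u : Fin n → ℝ} (hu : ∀ i, 0 ≤ u i) (i : Fin n) : 0 ≤ (m *ᵥ u) i :=
  show 0 ≤ ∑ j, m i j * u j from Finset.sum_nonneg fun j _ => mul_nonneg (hm i j) (hu j)

theorem copositive_congruence {m a : Matrix (Fin n) (Fin n) ℝ} (hm : ∀ i j, 0 ≤ m i j)
    (ha : Copositive a) : Copositive (mᵀ * a * m) := fun u hu => by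
  rw [dotProduct_congruence]
  exact ha _ (mulVec_nonneg_of_nonneg hm hu)

theorem isSymm_congruence (m : Matrix (Fin n) (Fin n) ℝ) {a : Matrix (Fin n) (Fin n) ℝ}
    (ha : a.IsSymm) : (mᵀ * a * m).IsSymm := by
  rw [Matrix.IsSymm, transpose_mul, transpose_mul, transpose_transpose, ha.eq, Matrix.mul_assoc]

theorem surjective_of_image_Cn {φ : Sn n →ₗ[ℝ] Sn n} (h : φ '' Cn n = Cn n) :
    Function.Surjective φ := fun x => by
  obtain ⟨c, h1, -⟩ := exists_smul_add_mem_Cn x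
  obtain ⟨y, -, hy⟩ := h.symm ▸ h1
  obtain ⟨z, -, hz⟩ := h.symm ▸ rankOne_mem_Cn (1 : Fin n → ℝ)
  exact ⟨y - c • z, by rw [map_sub, map_smul, hy, hz, add_sub_cancel_left]⟩

end

/-- Main theorem: φ(C_n) = C_n iff φ is a monomial congruence x ↦ mᵀxm. -/
theorem stmt_19 (n : ℕ) (φ : Sn n →ₗ[ℝ] Sn n) :
    φ '' Cn n = Cn n ↔
      ∃ m : Matrix (Fin n) (Fin n) ℝ, IsMonomial m ∧ (∀ i j, 0 ≤ m i j) ∧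
        ∀ x : Sn n, (φ x).1 = mᵀ * x.1 * m := by
  constructor
  · intro h
    have hsurj := surjective_of_image_Cn h
    obtain ⟨e, rfl⟩ : ∃ e : Sn n ≃ₗ[ℝ] Sn n, φ = e.toLinearMap :=
      ⟨LinearEquiv.ofBijective φ ⟨LinearMap.injective_iff_surjective.2 hsurj, hsurj⟩, rfl⟩
    have he (x : Sn n) : e x ∈ Cn n ↔ x ∈ Cn n := by
      have hx := e.injective.mem_set_image (s := Cn n) (a := x)
      rwa [show e '' Cn n = Cn n from h] at hx
    obtain ⟨m, hm, hmq⟩ := exists_matrix_quadEval_comp e he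
    obtain ⟨m', hm', hmq'⟩ := exists_matrix_quadEval_comp e.symm fun x => by
      rw [← he, e.apply_symm_apply]
    have hone : m' * m = 1 := by
      have hs (j : Fin n) : ∀ i, 0 ≤ (Pi.single j 1 : Fin n → ℝ) i := fun i => by
        by_cases h : i = j <;> simp [h]
      refine Matrix.ext_of_mulVec_single fun j => ?_
      have hms := mulVec_nonneg_of_nonneg hm (hs j)
      rw [Matrix.one_mulVec, ← mulVec_mulVec]
      refine eq_of_quadEval_eq (mulVec_nonneg_of_nonneg hm' hms) (hs j) fun x => ?_
      rw [← hmq' _ hms, ← hmq _ (hs j), e.apply_symm_apply]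
    refine ⟨m, isMonomial_of_mul_eq_one hm hm' (mul_eq_one_comm.1 hone), hm, fun x => ?_⟩
    refine congrArg Subtype.val
      (quadEval_ext (y := ⟨_, isSymm_congruence m x.2⟩) fun u hu => ?_)
    exact (hmq u hu x).trans (dotProduct_congruence m x.1 u).symm
  · rintro ⟨m, hmon, hm, hφ⟩
    obtain ⟨m', hm', hone⟩ := exists_nonneg_inverse hmon hm
    refine Set.Subset.antisymm ?_ fun y hy => ?_
    · rintro _ ⟨x, hx, rfl⟩
      have : Copositive (φ x).1 := by
        rw [hφ]
        exact copositive_congruence hm hx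
      exact this
    · refine ⟨⟨_, isSymm_congruence m' y.2⟩, copositive_congruence hm' hy, Subtype.ext ?_⟩
      have h1 : m' * m = 1 := mul_eq_one_comm.1 hone
      have h2 : mᵀ * m'ᵀ = 1 := by rw [← transpose_mul, h1, transpose_one]
      rw [hφ]
      calc mᵀ * (m'ᵀ * y.1 * m') * m = mᵀ * m'ᵀ * y.1 * (m' * m) := by
            simp only [Matrix.mul_assoc]
        _ = y.1 := by rw [h1, h2, Matrix.one_mul, Matrix.mul_one]
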